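/- Under the grid and stiffness-matrix definitions below with β∈(0,1), the entries of the stiffness matrix H satisfy: h_{i,j}<0 for all 1≤i,j≤M with j≠i, h_{i,i}>0 for all 1≤i≤M, and h_{i,i}+Σ_{j≠i} h_{i,j} > B₁(i)+B₂(i) for all 1≤i≤M; consequently every eigenvalue of the real symmetric matrix H is strictly greater than min_{1≤i≤M}(B₁(i)+B₂(i)) > 0, so H is symmetric positive definite. -/

import Mathlib

open MeasureTheory Set

noncomputable section

/-- Grid spacing `h = (b−a)/(M+1)`. -/
def gH (a b : ℝ) (M : ℕ) : ℝ := (b - a) / (M + 1)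

/-- Grid points `x_i = a + i h`, `i = 0,…,M+1`. -/
def gX (a b : ℝ) (M i : ℕ) : ℝ := a + i * gH a b M

/-- `A₁(i,s,k) = h^{−s−1} ∫_{x_{k−1}}^{x_k} (x_k−y)(x_i−y)^{s−1−β} dy`. -/
def cA1 (a b β : ℝ) (s M i k : ℕ) : ℝ :=
  gH a b M ^ (-(s : ℝ) - 1) *
    ∫ y in gX a b M (k - 1)..gX a b M k,
      (gX a b M k - y) * (gX a b M i - y) ^ ((s : ℝ) - 1 - β)

/-- `A₂(i,s,k) = h^{−s−1} ∫_{x_{k−1}}^{x_k} (y−x_{k−1})(x_i−y)^{s−1−β} dy`. -/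
def cA2 (a b β : ℝ) (s M i k : ℕ) : ℝ :=
  gH a b M ^ (-(s : ℝ) - 1) *
    ∫ y in gX a b M (k - 1)..gX a b M k,
      (y - gX a b M (k - 1)) * (gX a b M i - y) ^ ((s : ℝ) - 1 - β)

/-- `A₃(i,s,k) = h^{−s−1} ∫_{x_{k−1}}^{x_k} (x_k−y)(y−x_i)^{s−1−β} dy`. -/
def cA3 (a b β : ℝ) (s M i k : ℕ) : ℝ :=
  gH a b M ^ (-(s : ℝ) - 1) *
    ∫ y in gX a b M (k - 1)..gX a b M k,
      (gX a b M k - y) * (y - gX a b M i) ^ ((s : ℝ) - 1 - β)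

/-- `A₄(i,s,k) = h^{−s−1} ∫_{x_{k−1}}^{x_k} (y−x_{k−1})(y−x_i)^{s−1−β} dy`. -/
def cA4 (a b β : ℝ) (s M i k : ℕ) : ℝ :=
  gH a b M ^ (-(s : ℝ) - 1) *
    ∫ y in gX a b M (k - 1)..gX a b M k,
      (y - gX a b M (k - 1)) * (y - gX a b M i) ^ ((s : ℝ) - 1 - β)

/-- `B₁(i) = ∫_{−∞}^a e^{λ(y−x_i)} (x_i−y)^{−1−β} dy`. -/
def cB1 (a b β lam : ℝ) (M i : ℕ) : ℝ :=
  ∫ y in Iio a, Real.exp (lam * (y - gX a b M i)) * (gX a b M i - y) ^ (-1 - β)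

/-- `B₂(i) = ∫_b^∞ e^{λ(x_i−y)} (y−x_i)^{−1−β} dy`. -/
def cB2 (a b β lam : ℝ) (M i : ℕ) : ℝ :=
  ∫ y in Ioi b, Real.exp (lam * (gX a b M i - y)) * (y - gX a b M i) ^ (-1 - β)

/-- Off-diagonal entries `h_{i,j}` (in 1-based indexing, `1 ≤ i,j ≤ M`, `i ≠ j`) of the
stiffness matrix. -/
def offD (a b β lam : ℝ) (s s₁ M i j : ℕ) : ℝ :=
  if j + 2 ≤ i then
    -((cA1 a b β s M i (j + 1) + cA2 a b β s M i j) *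
        Real.exp (-lam * ((i : ℝ) - j) * gH a b M) * ((i : ℝ) - j) ^ (-(s : ℝ)))
  else if j + 1 = i then
    -(gH a b M ^ (-β) * Real.exp (-lam * gH a b M) / ((s₁ : ℝ) + 1 - β))
      - cA2 a b β s M i (i - 1) * Real.exp (-lam * gH a b M)
  else if j = i + 1 then
    -(gH a b M ^ (-β) * Real.exp (-lam * gH a b M) / ((s₁ : ℝ) + 1 - β))
      - cA3 a b β s M i (i + 2) * Real.exp (-lam * gH a b M)
  else if i + 2 ≤ j then
    -((cA3 a b β s M i (j + 1) + cA4 a b β s M i j) *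
        Real.exp (-lam * ((j : ℝ) - i) * gH a b M) * ((j : ℝ) - i) ^ (-(s : ℝ)))
  else 0

/-- The prescribed value of `h_{i,i} + Σ_{j≠i} h_{i,j} − B₁(i) − B₂(i)` (1-based index `i`). -/
def diagExtra (a b β lam : ℝ) (s s₁ M i : ℕ) : ℝ :=
  if i = 1 then
    gH a b M ^ (-β) * Real.exp (-lam * gH a b M) / ((s₁ : ℝ) + 1 - β)
      + cA4 a b β s M 1 (M + 1) * Real.exp (-lam * M * gH a b M) * (M : ℝ) ^ (-(s : ℝ))
  else if i = M then
    gH a b M ^ (-β) * Real.exp (-lam * gH a b M) / ((s₁ : ℝ) + 1 - β)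
      + cA1 a b β s M M 1 * Real.exp (-lam * M * gH a b M) * (M : ℝ) ^ (-(s : ℝ))
  else
    cA1 a b β s M i 1 * Real.exp (-lam * i * gH a b M) * (i : ℝ) ^ (-(s : ℝ))
      + cA4 a b β s M i (M + 1) * Real.exp (-lam * ((M : ℝ) + 1 - i) * gH a b M) *
          ((M : ℝ) + 1 - i) ^ (-(s : ℝ))

/-- The `M×M` stiffness matrix `H = (h_{i,j})`: off-diagonal entries given by `offD`, and
diagonal entries defined so that
`h_{i,i} + Σ_{j≠i} h_{i,j} − B₁(i) − B₂(i) = diagExtra i`. -/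
def stiff (a b β lam : ℝ) (s s₁ M : ℕ) : Matrix (Fin M) (Fin M) ℝ :=
  fun i j =>
    if i = j then
      cB1 a b β lam M (i.val + 1) + cB2 a b β lam M (i.val + 1)
        + diagExtra a b β lam s s₁ M (i.val + 1)
        - ∑ k ∈ Finset.univ.erase i, offD a b β lam s s₁ M (i.val + 1) (k.val + 1)
    else offD a b β lam s s₁ M (i.val + 1) (j.val + 1)

/-- `d₁(i) = ∫_{−∞}^a g(y) e^{−λ(x_i−y)} (x_i−y)^{−1−β} dy`. -/
def dd1 (a b β lam : ℝ) (g : ℝ → ℝ) (M i : ℕ) : ℝ :=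
  ∫ y in Iio a, g y * Real.exp (-lam * (gX a b M i - y)) * (gX a b M i - y) ^ (-1 - β)

/-- `d₂(i) = ∫_b^∞ g(y) e^{−λ(y−x_i)} (y−x_i)^{−1−β} dy`. -/
def dd2 (a b β lam : ℝ) (g : ℝ → ℝ) (M i : ℕ) : ℝ :=
  ∫ y in Ioi b, g y * Real.exp (-lam * (y - gX a b M i)) * (y - gX a b M i) ^ (-1 - β)

/-- The load vector `F`. -/
def loadF (a b β lam : ℝ) (s s₁ : ℕ) (f g u : ℝ → ℝ) (M : ℕ) : Fin M → ℝ :=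
  fun i =>
    f (gX a b M (i.val + 1)) + dd1 a b β lam g M (i.val + 1) + dd2 a b β lam g M (i.val + 1)
      + (if i.val + 1 = 1 then
            gH a b M ^ (-β) * Real.exp (-lam * gH a b M) / ((s₁ : ℝ) + 1 - β)
          else
            cA1 a b β s M (i.val + 1) 1 * Real.exp (-lam * ((i.val : ℝ) + 1) * gH a b M) *
              ((i.val : ℝ) + 1) ^ (-(s : ℝ))) * u a
      + (if i.val + 1 = M then
            gH a b M ^ (-β) * Real.exp (-lam * gH a b M) / ((s₁ : ℝ) + 1 - β)
          else
            cA4 a b β s M (i.val + 1) (M + 1) *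
              Real.exp (-lam * ((M : ℝ) - i.val) * gH a b M) *
              ((M : ℝ) - (i.val : ℝ)) ^ (-(s : ℝ))) * u b

/-- The discrete `L²` norm `‖v‖ = (h Σᵢ vᵢ²)^{1/2}`. -/
def dnorm2 (a b : ℝ) (M : ℕ) (v : Fin M → ℝ) : ℝ :=
  Real.sqrt (gH a b M * ∑ i, v i ^ 2)

end

lemma gH_pos {a b : ℝ} (hab : a < b) (M : ℕ) : 0 < gH a b M :=
  div_pos (sub_pos.2 hab) (by positivity)

lemma gX_succ (a b : ℝ) (M i : ℕ) : gX a b M (i + 1) = gX a b M i + gH a b M := by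
  simp only [gX]; push_cast; ring

lemma gX_strictMono {a b : ℝ} (hab : a < b) (M : ℕ) : StrictMono (gX a b M) :=
  strictMono_nat_of_lt_succ fun i => by
    rw [gX_succ]; exact lt_add_of_pos_right _ (gH_pos hab M)

lemma left_lt_gX {a b : ℝ} (hab : a < b) {M i : ℕ} (hi : 0 < i) : a < gX a b M i := by
  simpa [gX] using gX_strictMono hab M hi

lemma gX_lt_right {a b : ℝ} (hab : a < b) {M i : ℕ} (hi : i ≤ M) : gX a b M i < b := by
  have hlast : gX a b M (M + 1) = b := by
    have : (M : ℝ) + 1 ≠ 0 := by positivity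
    simp only [gX, gH]; push_cast; field_simp; ring
  exact (gX_strictMono hab M (Nat.lt_succ_of_le hi)).trans_eq hlast

lemma integral_mul_rpow_pos {u v p : ℝ} {f g : ℝ → ℝ} (huv : u < v)
    (hf : Continuous f) (hg : Continuous g) (hf_pos : ∀ y ∈ Ioo u v, 0 < f y)
    (hg_pos : ∀ y ∈ Icc u v, 0 < g y) : 0 < ∫ y in u..v, f y * g y ^ p := by
  refine intervalIntegral.intervalIntegral_pos_of_pos_on ?_ ?_ huv
  · refine ContinuousOn.intervalIntegrable ?_
    rw [uIcc_of_le huv.le]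
    exact hf.continuousOn.mul
      (hg.continuousOn.rpow_const fun y hy => Or.inl (hg_pos y hy).ne')
  · exact fun y hy =>
      mul_pos (hf_pos y hy) (Real.rpow_pos_of_pos (hg_pos y (Ioo_subset_Icc_self hy)) _)

section Coefficients

variable {a b : ℝ} (hab : a < b) (β : ℝ) (s M : ℕ) {i k : ℕ}
include hab

lemma cA1_pos (hk : 0 < k) (hki : k < i) : 0 < cA1 a b β s M i k := by
  have h := gX_strictMono hab M hki
  refine mul_pos (Real.rpow_pos_of_pos (gH_pos hab M) _)
    (integral_mul_rpow_pos (gX_strictMono hab M (by omega)) (by fun_prop) (by fun_prop) ?_ ?_)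
  · exact fun y hy => sub_pos.2 hy.2
  · exact fun y hy => sub_pos.2 (hy.2.trans_lt h)

lemma cA2_pos (hk : 0 < k) (hki : k < i) : 0 < cA2 a b β s M i k := by
  have h := gX_strictMono hab M hki
  refine mul_pos (Real.rpow_pos_of_pos (gH_pos hab M) _)
    (integral_mul_rpow_pos (gX_strictMono hab M (by omega)) (by fun_prop) (by fun_prop) ?_ ?_)
  · exact fun y hy => sub_pos.2 hy.1
  · exact fun y hy => sub_pos.2 (hy.2.trans_lt h)

lemma cA3_pos (hik : i + 2 ≤ k) : 0 < cA3 a b β s M i k := by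
  have h : gX a b M i < gX a b M (k - 1) := gX_strictMono hab M (by omega)
  refine mul_pos (Real.rpow_pos_of_pos (gH_pos hab M) _)
    (integral_mul_rpow_pos (gX_strictMono hab M (by omega)) (by fun_prop) (by fun_prop) ?_ ?_)
  · exact fun y hy => sub_pos.2 hy.2
  · exact fun y hy => sub_pos.2 (h.trans_le hy.1)

lemma cA4_pos (hik : i + 2 ≤ k) : 0 < cA4 a b β s M i k := by
  have h : gX a b M i < gX a b M (k - 1) := gX_strictMono hab M (by omega)
  refine mul_pos (Real.rpow_pos_of_pos (gH_pos hab M) _)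
    (integral_mul_rpow_pos (gX_strictMono hab M (by omega)) (by fun_prop) (by fun_prop) ?_ ?_)
  · exact fun y hy => sub_pos.2 hy.1
  · exact fun y hy => sub_pos.2 (h.trans_le hy.1)

end Coefficients

lemma cA1_succ_eq_cA4 (a b β : ℝ) (s M : ℕ) {i : ℕ} (hi : 0 < i) (j : ℕ) :
    cA1 a b β s M i (j + 1) = cA4 a b β s M j i := by
  obtain ⟨i, rfl⟩ := Nat.exists_eq_succ_of_ne_zero hi.ne'
  simp only [cA1, cA4, Nat.succ_eq_add_one, Nat.add_sub_cancel]
  have h := intervalIntegral.integral_comp_sub_left (a := gX a b M j) (b := gX a b M (j + 1))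
    (fun y => (y - gX a b M i) * (y - gX a b M j) ^ ((s : ℝ) - 1 - β))
    (gX a b M (i + 1) + gX a b M j)
  rw [add_sub_cancel_right] at h
  rw [show gX a b M i = gX a b M (i + 1) + gX a b M j - gX a b M (j + 1) by
    rw [gX_succ, gX_succ]; ring] at h ⊢
  rw [← h]
  congr 2 with y
  congr 1
  · ring
  · congr 1; ring

lemma cA2_eq_cA3_succ (a b β : ℝ) (s M : ℕ) (i : ℕ) {j : ℕ} (hj : 0 < j) :
    cA2 a b β s M i j = cA3 a b β s M j (i + 1) := by
  obtain ⟨j, rfl⟩ := Nat.exists_eq_succ_of_ne_zero hj.ne'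
  simp only [cA2, cA3, Nat.succ_eq_add_one, Nat.add_sub_cancel]
  have h := intervalIntegral.integral_comp_sub_left (a := gX a b M j) (b := gX a b M (j + 1))
    (fun y => (gX a b M (i + 1) - y) * (y - gX a b M (j + 1)) ^ ((s : ℝ) - 1 - β))
    (gX a b M i + gX a b M (j + 1))
  rw [add_sub_cancel_right, show gX a b M i + gX a b M (j + 1) - gX a b M j = gX a b M (i + 1) by
    rw [gX_succ, gX_succ]; ring] at h
  rw [← h]
  congr 2 with y
  congr 1
  · rw [gX_succ, gX_succ]; ring
  · congr 1; ring

lemma integral_Ioi_exp_mul_rpow_pos {lam p x c : ℝ} (hlam : 0 ≤ lam) (hp : p < -1)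
    (hxc : x < c) :
    0 < ∫ y in Ioi c, Real.exp (lam * (x - y)) * (y - x) ^ p := by
  have hpos : ∀ y ∈ Ioi c, 0 < Real.exp (lam * (x - y)) * (y - x) ^ p := fun y hy =>
    mul_pos (Real.exp_pos _) (Real.rpow_pos_of_pos (sub_pos.2 (hxc.trans hy)) _)
  have hint : IntegrableOn (fun y => Real.exp (lam * (x - y)) * (y - x) ^ p) (Ioi c) := by
    have h : IntegrableOn (fun y : ℝ => (y - x) ^ p) (Ioi c) := by
      simpa [sub_eq_add_neg] using
        integrableOn_add_rpow_Ioi_of_lt (m := -x) hp (by simpa using hxc)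
    refine Integrable.bdd_mul (c := 1) h (by fun_prop) ?_
    refine (ae_restrict_iff' measurableSet_Ioi).2 (.of_forall fun y hy => ?_)
    rw [Real.norm_eq_abs, Real.abs_exp, Real.exp_le_one_iff]
    exact mul_nonpos_of_nonneg_of_nonpos hlam (sub_nonpos.2 (hxc.trans hy).le)
  rw [setIntegral_pos_iff_support_of_nonneg_ae
    ((ae_restrict_iff' measurableSet_Ioi).2 (.of_forall fun y hy => (hpos y hy).le)) hint,
    inter_eq_right.2 fun y hy => Function.mem_support.2 (hpos y hy).ne', Real.volume_Ioi]
  exact ENNReal.zero_lt_top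

lemma cB2_pos {a b β lam : ℝ} (hab : a < b) (hβ : 0 < β) (hlam : 0 ≤ lam) {M i : ℕ}
    (hi : i ≤ M) : 0 < cB2 a b β lam M i :=
  integral_Ioi_exp_mul_rpow_pos hlam (by linarith) (gX_lt_right hab hi)

lemma cB1_pos {a b β lam : ℝ} (hab : a < b) (hβ : 0 < β) (hlam : 0 ≤ lam) {M i : ℕ}
    (hi : 0 < i) : 0 < cB1 a b β lam M i := by
  have h := integral_Ioi_exp_mul_rpow_pos (p := -1 - β) hlam (by linarith)
    (neg_lt_neg (left_lt_gX hab (M := M) hi))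
  have hreflect := integral_comp_neg_Ioi (-a)
    fun y => Real.exp (lam * (y - gX a b M i)) * (gX a b M i - y) ^ (-1 - β)
  rw [neg_neg, integral_Iic_eq_integral_Iio] at hreflect
  rw [cB1, ← hreflect]
  convert h using 5 <;> ring

lemma adjacent_pos {a b β : ℝ} (hab : a < b) (hβ : β < 1) (lam : ℝ) (s₁ M : ℕ) :
    0 < gH a b M ^ (-β) * Real.exp (-lam * gH a b M) / ((s₁ : ℝ) + 1 - β) := by
  have : (0 : ℝ) ≤ s₁ := s₁.cast_nonneg
  exact div_pos (mul_pos (Real.rpow_pos_of_pos (gH_pos hab M) _) (Real.exp_pos _)) (by linarith)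

lemma mul_exp_mul_rpow_pos {c d : ℝ} (hc : 0 < c) (hd : 0 < d) (t p : ℝ) :
    0 < c * Real.exp t * d ^ p :=
  mul_pos (mul_pos hc (Real.exp_pos _)) (Real.rpow_pos_of_pos hd _)

lemma offD_neg {a b β : ℝ} (hab : a < b) (hβ : β < 1) (lam : ℝ) (s s₁ M : ℕ) {i j : ℕ}
    (hj : 0 < j) (hij : i ≠ j) : offD a b β lam s s₁ M i j < 0 := by
  have hadj := adjacent_pos hab hβ lam s₁ M
  unfold offD
  split_ifs with h₁ h₂ h₃ h₄
  · have hlt : (j : ℝ) < i := by exact_mod_cast (by omega : j < i)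
    exact neg_neg_of_pos (mul_exp_mul_rpow_pos (add_pos (cA1_pos hab β s M (by omega) (by omega))
      (cA2_pos hab β s M hj (by omega))) (sub_pos.2 hlt) _ _)
  · have h := mul_pos (cA2_pos hab β s M (i := i) (k := i - 1) (by omega) (by omega))
      (Real.exp_pos (-lam * gH a b M))
    linarith
  · have h := mul_pos (cA3_pos hab β s M (i := i) le_rfl) (Real.exp_pos (-lam * gH a b M))
    linarith
  · have hlt : (i : ℝ) < j := by exact_mod_cast (by omega : i < j)
    exact neg_neg_of_pos (mul_exp_mul_rpow_pos (add_pos (cA3_pos hab β s M (by omega))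
      (cA4_pos hab β s M h₄)) (sub_pos.2 hlt) _ _)
  · omega

lemma offD_comm_of_lt (a b β lam : ℝ) (s s₁ M : ℕ) {i j : ℕ} (hi : 0 < i) (hij : i < j) :
    offD a b β lam s s₁ M i j = offD a b β lam s s₁ M j i := by
  rcases Nat.lt_or_ge (i + 1) j with h | h
  · rw [offD, if_neg (by omega), if_neg (by omega), if_neg (by omega), if_pos (by omega), offD,
      if_pos (by omega), cA1_succ_eq_cA4 a b β s M (by omega), cA2_eq_cA3_succ a b β s M j hi,
      add_comm (cA4 a b β s M i j)]
  · obtain rfl : j = i + 1 := by omega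
    rw [offD, if_neg (by omega), if_neg (by omega), if_pos rfl, offD, if_neg (by omega),
      if_pos rfl, Nat.add_sub_cancel, cA2_eq_cA3_succ a b β s M (i + 1) hi]

lemma diagExtra_pos {a b β : ℝ} (hab : a < b) (hβ : β < 1) (lam : ℝ) (s s₁ : ℕ) {M i : ℕ}
    (hM : 2 ≤ M) (hi : 0 < i) (hiM : i ≤ M) : 0 < diagExtra a b β lam s s₁ M i := by
  have hadj := adjacent_pos hab hβ lam s₁ M
  have hM_pos : (0 : ℝ) < M := by exact_mod_cast (by omega : 0 < M)
  unfold diagExtra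
  split_ifs with h₁ h₂
  · exact add_pos hadj (mul_exp_mul_rpow_pos (cA4_pos hab β s M (by omega)) hM_pos _ _)
  · exact add_pos hadj
      (mul_exp_mul_rpow_pos (cA1_pos hab β s M one_pos (by omega)) hM_pos _ _)
  · have hi_pos : (0 : ℝ) < i := by exact_mod_cast hi
    have hiM' : (i : ℝ) ≤ M := by exact_mod_cast hiM
    exact add_pos
      (mul_exp_mul_rpow_pos (cA1_pos hab β s M one_pos (by omega)) hi_pos _ _)
      (mul_exp_mul_rpow_pos (cA4_pos hab β s M (by omega)) (by linarith) _ _)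

/-- A real number strictly below every row sum of a matrix with nonpositive off-diagonal entries
lies strictly below every eigenvalue. -/
lemma lt_eigenvalue_of_lt_row_sum {n : Type*} [Fintype n] [DecidableEq n] {A : Matrix n n ℝ}
    {c μ : ℝ} (hoff : ∀ i j, j ≠ i → A i j ≤ 0)
    (hrow : ∀ i, c < A i i + ∑ j ∈ Finset.univ.erase i, A i j)
    (hμ : Module.End.HasEigenvalue (Matrix.toLin' A) μ) : c < μ := by
  obtain ⟨k, hk⟩ := eigenvalue_mem_ball hμ
  have hnorm : ∑ j ∈ Finset.univ.erase k, ‖A k j‖ = -∑ j ∈ Finset.univ.erase k, A k j := by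
    rw [← Finset.sum_neg_distrib]
    exact Finset.sum_congr rfl fun j hj => by
      rw [Real.norm_eq_abs, abs_of_nonpos (hoff k j (Finset.ne_of_mem_erase hj))]
  rw [hnorm, Metric.mem_closedBall, Real.dist_eq] at hk
  linarith [hrow k, neg_le_of_abs_le hk]

/-- A real symmetric matrix whose eigenvalues are all positive is positive definite. -/
lemma posDef_of_isSymm_of_eigenvalue_pos {n : Type*} [Fintype n] [DecidableEq n]
    {A : Matrix n n ℝ} (hA : A.IsSymm)
    (hpos : ∀ μ, Module.End.HasEigenvalue (Matrix.toLin' A) μ → 0 < μ) : A.PosDef := by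
  have hH : A.IsHermitian := by
    rw [Matrix.IsHermitian, Matrix.conjTranspose_eq_transpose_of_trivial, hA.eq]
  refine hH.posDef_iff_eigenvalues_pos.2 fun i => hpos _ ?_
  rw [Module.End.hasEigenvalue_iff_mem_spectrum, Matrix.spectrum_toLin']
  exact hH.eigenvalues_mem_spectrum_real i

noncomputable section

open MeasureTheory Set

/-- for `β ∈ (0,1)` the stiffness matrix `H` of the finite difference scheme
satisfies `h_{i,j} < 0` for `j ≠ i`, `h_{i,i} > 0`, and
`h_{i,i} + Σ_{j≠i} h_{i,j} > B₁(i) + B₂(i)`; consequently every eigenvalue of the real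
symmetric matrix `H` is strictly greater than `min_i (B₁(i)+B₂(i)) > 0`, so `H` is symmetric
positive definite. -/
theorem stiffness_matrix_posdef (a b β lam : ℝ) (s s₁ : ℕ)
    (hab : a < b) (hβ : β ∈ Set.Ioo (0 : ℝ) 1) (hlam : 0 ≤ lam)
    (hs : s = 0 ∨ s = 1) (hs₁ : s₁ = 0 ∨ s₁ = 1)
    (M : ℕ) (hM : 3 ≤ M) :
    (∀ i j : Fin M, j ≠ i → stiff a b β lam s s₁ M i j < 0) ∧
    (∀ i : Fin M, 0 < stiff a b β lam s s₁ M i i) ∧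
    (∀ i : Fin M,
      cB1 a b β lam M (i.val + 1) + cB2 a b β lam M (i.val + 1) <
        stiff a b β lam s s₁ M i i
          + ∑ j ∈ Finset.univ.erase i, stiff a b β lam s s₁ M i j) ∧
    (0 < Finset.univ.inf' ⟨⟨0, by omega⟩, Finset.mem_univ _⟩
        (fun i : Fin M => cB1 a b β lam M (i.val + 1) + cB2 a b β lam M (i.val + 1))) ∧
    (∀ μ : ℝ, Module.End.HasEigenvalue (Matrix.toLin' (stiff a b β lam s s₁ M)) μ →
      Finset.univ.inf' ⟨⟨0, by omega⟩, Finset.mem_univ _⟩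
        (fun i : Fin M => cB1 a b β lam M (i.val + 1) + cB2 a b β lam M (i.val + 1)) < μ) ∧
    (stiff a b β lam s s₁ M).IsSymm ∧ (stiff a b β lam s s₁ M).PosDef := by
  obtain ⟨hβ_pos, hβ_lt⟩ := hβ
  have hoffD : ∀ i j : Fin M, j ≠ i → offD a b β lam s s₁ M (i.val + 1) (j.val + 1) < 0 :=
    fun i j hji => offD_neg hab hβ_lt lam s s₁ M j.val.succ_pos (by omega)
  have hentry : ∀ i j : Fin M, j ≠ i →
      stiff a b β lam s s₁ M i j = offD a b β lam s s₁ M (i.val + 1) (j.val + 1) :=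
    fun i j hji => if_neg hji.symm
  have hoff : ∀ i j : Fin M, j ≠ i → stiff a b β lam s s₁ M i j < 0 := fun i j hji =>
    (hentry i j hji).trans_lt (hoffD i j hji)
  have hrow : ∀ i : Fin M, cB1 a b β lam M (i.val + 1) + cB2 a b β lam M (i.val + 1) <
      stiff a b β lam s s₁ M i i + ∑ j ∈ Finset.univ.erase i, stiff a b β lam s s₁ M i j := by
    intro i
    have hextra := diagExtra_pos hab hβ_lt lam s s₁ (by omega) i.val.succ_pos i.isLt
    rw [Finset.sum_congr rfl fun j hj => hentry i j (Finset.ne_of_mem_erase hj), stiff, if_pos rfl]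
    linarith
  have hB : ∀ i : Fin M, 0 < cB1 a b β lam M (i.val + 1) + cB2 a b β lam M (i.val + 1) :=
    fun i => add_pos (cB1_pos hab hβ_pos hlam i.val.succ_pos) (cB2_pos hab hβ_pos hlam i.isLt)
  have hinf : 0 < Finset.univ.inf' ⟨⟨0, by omega⟩, Finset.mem_univ _⟩
      (fun i : Fin M => cB1 a b β lam M (i.val + 1) + cB2 a b β lam M (i.val + 1)) :=
    (Finset.lt_inf'_iff _).2 fun i _ => hB i
  have heig : ∀ μ : ℝ, Module.End.HasEigenvalue (Matrix.toLin' (stiff a b β lam s s₁ M)) μ →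
      Finset.univ.inf' ⟨⟨0, by omega⟩, Finset.mem_univ _⟩
        (fun i : Fin M => cB1 a b β lam M (i.val + 1) + cB2 a b β lam M (i.val + 1)) < μ :=
    fun μ => lt_eigenvalue_of_lt_row_sum (fun i j hji => (hoff i j hji).le) fun i =>
      (Finset.inf'_le _ (Finset.mem_univ i)).trans_lt (hrow i)
  have hsymm : (stiff a b β lam s s₁ M).IsSymm := by
    refine Matrix.IsSymm.ext fun i j => ?_
    rcases lt_trichotomy i j with h | rfl | h
    · rw [hentry j i h.ne, hentry i j h.ne']
      exact (offD_comm_of_lt a b β lam s s₁ M i.val.succ_pos (Nat.succ_lt_succ h)).symm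
    · rfl
    · rw [hentry j i h.ne', hentry i j h.ne]
      exact offD_comm_of_lt a b β lam s s₁ M j.val.succ_pos (Nat.succ_lt_succ h)
  refine ⟨hoff, fun i => ?_, hrow, hinf, heig, hsymm,
    posDef_of_isSymm_of_eigenvalue_pos hsymm fun μ hμ => hinf.trans (heig μ hμ)⟩
  have hsum : ∑ j ∈ Finset.univ.erase i, stiff a b β lam s s₁ M i j ≤ 0 :=
    Finset.sum_nonpos fun j hj => (hoff i j (Finset.ne_of_mem_erase hj)).le
  linarith [hB i, hrow i]

end
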